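/- There is an absolute constant C such that the following holds for all 0 < δ ≤ ρ ≤ 1. Let 𝕋 be a finite multiset of δ-tubes contained in the unit ball of ℝ³ and let 𝕋_ρ be a set of ρ-tubes that covers 𝕋 (every T ∈ 𝕋 is contained in some T_ρ ∈ 𝕋_ρ). Then C_{KT-CW}(𝕋) ≤ C · (sup_{T_ρ∈𝕋_ρ} C_{KT-CW}(𝕋^{T_ρ})) · C_{KT-CW}(𝕋_ρ). -/

import Mathlib

open MeasureTheory Metric Set
open scoped Classical

noncomputable section

abbrev E3 : Type := EuclideanSpace ℝ (Fin 3)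

/-- The Lebesgue volume of a subset of `ℝ³`, as a real number. -/
def vol (s : Set E3) : ℝ := (MeasureTheory.volume s).toReal

/-- `T` is a `δ`-tube: the closed `δ`-neighbourhood of a line segment of unit length. -/
def IsTube (δ : ℝ) (T : Set E3) : Prop :=
  ∃ x e : E3, ‖e‖ = 1 ∧ T = Metric.cthickening δ (segment ℝ x (x + e))

/-- The common volume of a `δ`-tube (all `δ`-tubes are congruent). -/
def tubeVol (δ : ℝ) : ℝ :=
  vol (Metric.cthickening δ (segment ℝ (0 : E3) (EuclideanSpace.single (0 : Fin 3) (1 : ℝ))))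

/-- Two sets are essentially distinct if their intersection has volume at most half of the
larger of their two volumes. -/
def EssentiallyDistinct (U V : Set E3) : Prop :=
  vol (U ∩ V) ≤ max (vol U) (vol V) / 2

/-- `(𝕋, Y)_δ`: a finite set of pairwise essentially distinct `δ`-tubes contained in the unit
ball, together with a measurable shading `Y T ⊆ T` of each tube. -/
def TubePair (δ : ℝ) (𝕋 : Finset (Set E3)) (Y : Set E3 → Set E3) : Prop :=
  (∀ T ∈ 𝕋, IsTube δ T ∧ T ⊆ Metric.closedBall 0 1 ∧ Y T ⊆ T ∧ MeasurableSet (Y T)) ∧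
    ∀ T ∈ 𝕋, ∀ T' ∈ 𝕋, T ≠ T' → EssentiallyDistinct T T'

/-- The pair `(𝕋, Y)` is `λ`-dense. -/
def ShadingDense (lam : ℝ) (𝕋 : Finset (Set E3)) (Y : Set E3 → Set E3) : Prop :=
  lam * ∑ T ∈ 𝕋, vol T ≤ ∑ T ∈ 𝕋, vol (Y T)

/-- The Katz–Tao Convex Wolff constant of a finite family of `δ`-tubes: the infimum of all
`C > 0` such that every (bounded) convex set `W` contains at most `C·|W|·|T|⁻¹` tubes. -/
def KTCW (δ : ℝ) (𝕋 : Finset (Set E3)) : ℝ :=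
  sInf {C : ℝ | 0 < C ∧ ∀ W : Set E3, Convex ℝ W → Bornology.IsBounded W →
    (Set.ncard {T | T ∈ 𝕋 ∧ T ⊆ W} : ℝ) ≤ C * vol W / tubeVol δ}

/-- A slab: the intersection of the unit ball with the thickened neighbourhood of a plane. -/
def IsSlab (W : Set E3) : Prop :=
  ∃ (H : AffineSubspace ℝ E3) (r : ℝ), 0 < r ∧ (H : Set E3).Nonempty ∧
    Module.finrank ℝ H.direction = 2 ∧
    W = Metric.closedBall 0 1 ∩ Metric.cthickening r (H : Set E3)

/-- The Frostman Slab Wolff constant of a finite family of `δ`-tubes: the infimum of all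
`C > 0` such that every slab `W` contains at most `C·|W|·#𝕋` tubes. -/
def FSW (𝕋 : Finset (Set E3)) : ℝ :=
  sInf {C : ℝ | 0 < C ∧ ∀ W : Set E3, IsSlab W →
    (Set.ncard {T | T ∈ 𝕋 ∧ T ⊆ W} : ℝ) ≤ C * vol W * (𝕋.card : ℝ)}

/-- Assertion `𝒟(σ, ω)`. -/
def AssertD (σ ω : ℝ) : Prop :=
  ∀ ε : ℝ, 0 < ε → ∃ κ : ℝ, 0 < κ ∧ ∃ η : ℝ, 0 < η ∧ ∀ δ : ℝ, 0 < δ →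
    ∀ (𝕋 : Finset (Set E3)) (Y : Set E3 → Set E3),
      TubePair δ 𝕋 Y → ShadingDense (δ ^ η) 𝕋 Y →
      KTCW δ 𝕋 ≤ δ ^ (-η) → FSW 𝕋 ≤ δ ^ (-η) →
      κ * δ ^ (ω + ε) * ((𝕋.card : ℝ) * tubeVol δ) *
          ((𝕋.card : ℝ) * tubeVol δ ^ ((1 : ℝ) / 2)) ^ (-σ)
        ≤ vol (⋃ T ∈ 𝕋, Y T)

/-- Assertion `ℰ(σ, ω)`. -/
def AssertE (σ ω : ℝ) : Prop :=
  ∀ ε : ℝ, 0 < ε → ∃ κ : ℝ, 0 < κ ∧ ∃ η : ℝ, 0 < η ∧ ∀ δ : ℝ, 0 < δ →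
    ∀ (𝕋 : Finset (Set E3)) (Y : Set E3 → Set E3),
      TubePair δ 𝕋 Y → ShadingDense (δ ^ η) 𝕋 Y →
      κ * δ ^ (ω + ε) * (KTCW δ 𝕋)⁻¹ * ((𝕋.card : ℝ) * tubeVol δ) *
          ((KTCW δ 𝕋) ^ (-(3 : ℝ) / 2) * FSW 𝕋 *
            ((𝕋.card : ℝ) * tubeVol δ ^ ((1 : ℝ) / 2))) ^ (-σ)
        ≤ vol (⋃ T ∈ 𝕋, Y T)

/-- The Katz–Tao Convex Wolff constant of a sub-multiset `s` of an indexed family `T` of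
tubes, normalised by the tube volume `v`: the infimum of all `C > 0` such that every
bounded convex `W` contains at most `C·|W|·v⁻¹` members (with multiplicity).  By affine
invariance of the ratio form, for `s = {i | T i ⊆ T_ρ}` and `v = |T|` this is exactly
`C_{KT-CW}(𝕋^{T_ρ})`. -/
def KTCWfam {ι : Type} [Fintype ι] (v : ℝ) (T : ι → Set E3) (s : Set ι) : ℝ :=
  sInf {C : ℝ | 0 < C ∧ ∀ W : Set E3, Convex ℝ W → Bornology.IsBounded W →
    (Set.ncard {i | i ∈ s ∧ T i ⊆ W} : ℝ) ≤ C * vol W / v}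

section NeighbourhoodEstimates

open scoped Pointwise

/-- The tube constraints pass to the infimum, as soon as some constant satisfies them. -/
theorem le_sInf_mul_vol {n : Set E3 → ℕ} {N : ℕ} {c v : ℝ} (hc : 0 < c) (hv : 0 < v)
    (hN : ∀ W, n W ≤ N)
    (hn : ∀ W, Convex ℝ W → Bornology.IsBounded W → n W ≠ 0 → c ≤ vol W)
    {W : Set E3} (hW : Convex ℝ W) (hWb : Bornology.IsBounded W) :
    (n W : ℝ) ≤ sInf {C : ℝ | 0 < C ∧ ∀ W : Set E3, Convex ℝ W → Bornology.IsBounded W →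
      (n W : ℝ) ≤ C * vol W / v} * vol W / v := by
  set S := {C : ℝ | 0 < C ∧ ∀ W : Set E3, Convex ℝ W → Bornology.IsBounded W →
      (n W : ℝ) ≤ C * vol W / v}
  have hne : S.Nonempty := by
    refine ⟨((N : ℝ) + 1) * v / c, by positivity, fun U hU hUb => ?_⟩
    have hvol : 0 ≤ vol U := ENNReal.toReal_nonneg
    by_cases h0 : n U = 0
    · rw [h0]
      push_cast
      positivity
    · have h1 := hn U hU hUb h0
      have h2 : (n U : ℝ) ≤ N := by exact_mod_cast hN U
      have h3 : ((N : ℝ) + 1) * v / c * vol U / v = (N + 1) * (vol U / c) := by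
        field_simp
      rw [h3]
      have h4 : 1 ≤ vol U / c := (one_le_div hc).2 h1
      have h5 : (0 : ℝ) ≤ N := Nat.cast_nonneg N
      nlinarith
  have hvol : 0 ≤ vol W := ENNReal.toReal_nonneg
  rcases hvol.eq_or_lt with h0 | hpos
  · obtain ⟨C, hC⟩ := hne
    have := hC.2 W hW hWb
    rw [← h0] at this ⊢
    simpa using this
  · rw [le_div_iff₀ hv, ← div_le_iff₀ hpos]
    refine le_csInf hne fun C hC => ?_
    rw [div_le_iff₀ hpos, ← le_div_iff₀ hv]
    exact hC.2 W hW hWb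

theorem tube_eq_add {r : ℝ} (hr : 0 ≤ r) (x y : E3) :
    cthickening r (segment ℝ x y) = segment ℝ x y + closedBall (0 : E3) r :=
  (IsCompact.add_closedBall_zero (by
    rw [← convexHull_pair (𝕜 := ℝ)]
    exact (Set.toFinite {x, y}).isCompact_convexHull ℝ) hr).symm

theorem IsTube.isCompact {r : ℝ} (hr : 0 ≤ r) {T : Set E3} (hT : IsTube r T) : IsCompact T := by
  obtain ⟨x, e, -, rfl⟩ := hT
  rw [tube_eq_add hr]
  refine IsCompact.add ?_ (isCompact_closedBall 0 r)
  rw [← convexHull_pair (𝕜 := ℝ)]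
  exact (Set.toFinite _).isCompact_convexHull ℝ

theorem IsTube.convex {r : ℝ} {T : Set E3} (hT : IsTube r T) : Convex ℝ T := by
  obtain ⟨x, e, -, rfl⟩ := hT
  exact (convex_segment x (x + e)).cthickening r

theorem IsTube.exists_closedBall_subset {r : ℝ} {T : Set E3} (hT : IsTube r T) :
    ∃ x, closedBall x r ⊆ T := by
  obtain ⟨x, e, -, rfl⟩ := hT
  exact ⟨x, closedBall_subset_cthickening (left_mem_segment ℝ x (x + e)) r⟩

theorem vol_mono {A B : Set E3} (h : A ⊆ B) (hB : Bornology.IsBounded B) : vol A ≤ vol B :=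
  ENNReal.toReal_mono hB.measure_lt_top.ne (measure_mono h)

theorem vol_closedBall_pos {r : ℝ} (hr : 0 < r) : 0 < vol (closedBall (0 : E3) r) :=
  ENNReal.toReal_pos (measure_closedBall_pos volume 0 hr).ne'
    isBounded_closedBall.measure_lt_top.ne

theorem vol_closedBall_le {r : ℝ} {x : E3} {W : Set E3} (hW : Bornology.IsBounded W)
    (h : closedBall x r ⊆ W) : vol (closedBall (0 : E3) r) ≤ vol W := by
  refine le_trans (le_of_eq ?_) (vol_mono h hW)
  simp only [vol, Measure.addHaar_closedBall_center]

/-- All `r`-tubes have the same volume. -/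
theorem IsTube.vol_eq {r : ℝ} (hr : 0 ≤ r) {T : Set E3} (hT : IsTube r T) :
    vol T = tubeVol r := by
  obtain ⟨x, e, he, rfl⟩ := hT
  set e₁ : E3 := EuclideanSpace.single (0 : Fin 3) (1 : ℝ) with he₁
  have hn : ‖e₁‖ = ‖e‖ := by rw [he, he₁]; simp
  set R : E3 ≃ₗᵢ[ℝ] E3 := Submodule.reflection (ℝ ∙ (e₁ - e))ᗮ with hR
  have hRe : R e₁ = e := Submodule.reflection_sub hn
  have hseg : segment ℝ x (x + e) = x +ᵥ (R '' segment ℝ (0 : E3) e₁) := by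
    have h1 : R '' segment ℝ (0 : E3) e₁ = segment ℝ (0 : E3) e := by
      have := image_segment ℝ (R.toLinearEquiv.toLinearMap.toAffineMap) (0 : E3) e₁
      simpa [hRe] using this
    have h2 := segment_translate_image ℝ x 0 e
    rw [add_zero] at h2
    rw [h1, ← h2]
    rfl
  have himg : cthickening r (segment ℝ x (x + e)) =
      x +ᵥ (R '' cthickening r (segment ℝ (0 : E3) e₁)) := by
    have h3 : R '' closedBall (0 : E3) r = closedBall (0 : E3) r := by
      simp
    have h4 : cthickening r (segment ℝ (0 : E3) e₁) =
      segment ℝ (0 : E3) e₁ + closedBall (0 : E3) r := tube_eq_add hr _ _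
    rw [tube_eq_add hr, hseg, h4, Set.image_add, h3, vadd_add_assoc]
  unfold tubeVol vol
  rw [himg, measure_vadd, ← he₁]
  congr 1
  rw [← LinearIsometryEquiv.coe_toHomeomorph, Homeomorph.image_eq_preimage_symm]
  exact R.symm.measurePreserving.measure_preimage_equiv
    (f := R.symm.toHomeomorph.toMeasurableEquiv) _

/-- An elementary form of the Rogers–Shephard inequality. -/
theorem volume_inter_mul_volume_sub_le {K L : Set E3} (hK : IsCompact K) (hL : IsCompact L)
    (hKc : Convex ℝ K) (hLc : Convex ℝ L) :
    volume (K ∩ L) * volume (K - L) ≤ 64 * (volume K * volume L) := by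
  have hpow : ENNReal.ofReal |((1 / 2 : ℝ)) ^ Module.finrank ℝ E3| = 8⁻¹ := by
    rw [finrank_euclideanSpace_fin, abs_of_pos (by positivity),
      show ((1 / 2 : ℝ)) ^ 3 = 8⁻¹ by norm_num, ENNReal.ofReal_inv_of_pos (by norm_num)]
    norm_num
  set P : Set (E3 × E3) := {p | p.2 ∈ K ∧ p.2 - p.1 ∈ L} with hP
  have hPm : MeasurableSet P :=
    (measurable_snd hK.measurableSet).inter
      ((measurable_snd.sub measurable_fst) hL.measurableSet)
  have hup : (volume.prod volume) P = volume K * volume L := by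
    rw [Measure.prod_apply_symm hPm]
    have : ∀ y : E3, volume ((fun x => (x, y)) ⁻¹' P) = K.indicator (fun _ => volume L) y := by
      intro y
      by_cases hy : y ∈ K
      · have h1 : (fun x => (x, y)) ⁻¹' P = (fun x => y - x) ⁻¹' L := by
          ext x; simp [hP, hy]
        rw [h1, Set.indicator_of_mem hy]
        exact (Measure.measurePreserving_sub_left volume y).measure_preimage
          hL.measurableSet.nullMeasurableSet
      · have h1 : (fun x => (x, y)) ⁻¹' P = ∅ := by
          ext x; simp [hP, hy]
        rw [h1, Set.indicator_of_notMem hy, measure_empty]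
    simp_rw [this]
    rw [lintegral_indicator_const hK.measurableSet, mul_comm]
  have hlow : ∀ x ∈ (1 / 2 : ℝ) • (K - L), 8⁻¹ * volume (K ∩ L) ≤ volume (Prod.mk x ⁻¹' P) := by
    rintro _ ⟨_, ⟨k, hk, l, hl, rfl⟩, rfl⟩
    rw [← hpow, ← Measure.addHaar_smul, ← measure_vadd volume ((1 / 2 : ℝ) • k)]
    refine measure_mono ?_
    rintro _ ⟨_, ⟨z, ⟨hzK, hzL⟩, rfl⟩, rfl⟩
    refine ⟨?_, ?_⟩
    · exact hKc hk hzK (by norm_num) (by norm_num) (by norm_num)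
    · have := hLc hl hzL (a := 1 / 2) (b := 1 / 2) (by norm_num) (by norm_num) (by norm_num)
      convert this using 1
      simp only [vadd_eq_add]
      module
  have hD : MeasurableSet ((1 / 2 : ℝ) • (K - L)) := by
    rw [sub_eq_add_neg]
    exact ((hK.add hL.neg).smul _).measurableSet
  have hmain : 8⁻¹ * volume (K ∩ L) * (8⁻¹ * volume (K - L)) ≤ volume K * volume L := by
    have hvol : volume ((1 / 2 : ℝ) • (K - L)) = 8⁻¹ * volume (K - L) := by
      rw [Measure.addHaar_smul, hpow]
    rw [← hup, Measure.prod_apply hPm, ← hvol, ← setLIntegral_const]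
    exact (setLIntegral_mono' hD hlow).trans (setLIntegral_le_lintegral _ _)
  calc volume (K ∩ L) * volume (K - L)
      = 64 * (8⁻¹ * volume (K ∩ L) * (8⁻¹ * volume (K - L))) := by
        have h8 : (8 : ENNReal) * 8⁻¹ = 1 := ENNReal.mul_inv_cancel (by norm_num) (by norm_num)
        have h64 : (64 : ENNReal) = 8 * 8 := by norm_num
        calc _ = (8 * 8⁻¹) * (8 * 8⁻¹) * (volume (K ∩ L) * volume (K - L)) := by
              rw [h8]; ring
          _ = _ := by rw [h64]; ring
    _ ≤ _ := by gcongr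

/-- If `L` contains an `r`-ball, the `4r`-neighbourhood of `K` is controlled by `K - L`. -/
theorem volume_add_closedBall_le {K L : Set E3} (hKc : Convex ℝ K) (hKne : K.Nonempty)
    {x : E3} {r : ℝ} (hx : closedBall x r ⊆ L) :
    volume (K + closedBall (0 : E3) (4 * r)) ≤ 64 * volume (K - L) := by
  obtain ⟨w, hw⟩ := hKne
  have hpow : ENNReal.ofReal |(4 : ℝ) ^ Module.finrank ℝ E3| = 64 := by
    rw [finrank_euclideanSpace_fin]; norm_num
  rw [← hpow, ← Measure.addHaar_smul,
    ← measure_vadd volume ((4 : ℝ) • x - (3 : ℝ) • w) ((4 : ℝ) • (K - L))]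
  refine measure_mono ?_
  rintro _ ⟨k, hk, v, hv, rfl⟩
  have h1 := hKc hk hw (a := 1 / 4) (b := 3 / 4) (by norm_num) (by norm_num) (by norm_num)
  have h2 : x - (1 / 4 : ℝ) • v ∈ L := by
    apply hx
    rw [mem_closedBall_zero_iff] at hv
    rw [mem_closedBall, dist_eq_norm, sub_sub_cancel_left, norm_neg, norm_smul]
    norm_num
    linarith
  refine ⟨_, ⟨_, ⟨_, h1, _, h2, rfl⟩, rfl⟩, ?_⟩
  simp only [vadd_eq_add]
  module

theorem vol_inter_mul_vol_add_closedBall_le {K L : Set E3} (hK : IsCompact K) (hL : IsCompact L)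
    (hKc : Convex ℝ K) (hLc : Convex ℝ L) {x : E3} {r : ℝ} (hx : closedBall x r ⊆ L) :
    vol (K ∩ L) * vol (K + closedBall (0 : E3) (4 * r)) ≤ 4096 * (vol K * vol L) := by
  rcases K.eq_empty_or_nonempty with rfl | hKne
  · simp [vol]
  have h : volume (K ∩ L) * volume (K + closedBall (0 : E3) (4 * r)) ≤
      4096 * (volume K * volume L) :=
    calc _ ≤ volume (K ∩ L) * (64 * volume (K - L)) := by
          gcongr
          exact volume_add_closedBall_le hKc hKne hx
      _ = 64 * (volume (K ∩ L) * volume (K - L)) := by ring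
      _ ≤ 64 * (64 * (volume K * volume L)) := by
          exact mul_le_mul_right (volume_inter_mul_volume_sub_le hK hL hKc hLc) 64
      _ = 4096 * (volume K * volume L) := by rw [← mul_assoc]; norm_num
  have h' := ENNReal.toReal_mono (ENNReal.mul_ne_top (by norm_num)
    (ENNReal.mul_ne_top hK.measure_lt_top.ne hL.measure_lt_top.ne)) h
  simpa [vol, ENNReal.toReal_mul] using h'

/-- A `ρ`-tube containing a `δ`-tube lies in the `4ρ`-neighbourhood of any convex set
containing that `δ`-tube. -/
theorem IsTube.subset_add_closedBall {δ ρ : ℝ} (hρ : 0 ≤ ρ) {T U W : Set E3}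
    (hT : IsTube δ T) (hU : IsTube ρ U) (hTU : T ⊆ U) (hW : Convex ℝ W) (hTW : T ⊆ W) :
    U ⊆ W + closedBall (0 : E3) (4 * ρ) := by
  obtain ⟨y, f, hf, rfl⟩ := hT
  obtain ⟨x, e, he, rfl⟩ := hU
  have hseg := self_subset_cthickening (δ := δ) (segment ℝ y (y + f))
  have hy := hseg (left_mem_segment ℝ y (y + f))
  have hyf := hseg (right_mem_segment ℝ y (y + f))
  have key : ∀ p q : E3, p ∈ W → q ∈ W → ∀ s t : ℝ, 0 ≤ s → t ≤ 1 → 1 - 2 * ρ ≤ t - s →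
      ‖p - (x + s • e)‖ ≤ ρ → ‖q - (x + t • e)‖ ≤ ρ →
      ∀ u : ℝ, 0 ≤ u → u ≤ 1 → ∃ w ∈ W, ‖x + u • e - w‖ ≤ 3 * ρ := by
    intro p q hp hq s t hs ht hst hps hqt u hu0 hu1
    refine ⟨(1 - u) • p + u • q, hW hp hq (by linarith) hu0 (by ring), ?_⟩
    have h1 : x + u • e - ((1 - u) • p + u • q) =
        (u * (1 - t) - s * (1 - u)) • e -
          ((1 - u) • (p - (x + s • e)) + u • (q - (x + t • e))) := by module
    have h2 : |u * (1 - t) - s * (1 - u)| ≤ 2 * ρ := by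
      rw [abs_le]; constructor <;> nlinarith
    have h3 : ‖(1 - u) • (p - (x + s • e)) + u • (q - (x + t • e))‖ ≤ ρ := by
      refine (norm_add_le _ _).trans ?_
      rw [norm_smul, norm_smul, Real.norm_of_nonneg hu0, Real.norm_of_nonneg (by linarith)]
      nlinarith
    rw [h1]
    refine (norm_sub_le _ _).trans ?_
    rw [norm_smul, he, mul_one, Real.norm_eq_abs]
    linarith
  have near : ∀ p ∈ cthickening ρ (segment ℝ x (x + e)),
      ∃ s : ℝ, 0 ≤ s ∧ s ≤ 1 ∧ ‖p - (x + s • e)‖ ≤ ρ := by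
    intro p hp
    rw [tube_eq_add hρ] at hp
    obtain ⟨z, hz, v, hv, rfl⟩ := hp
    rw [segment_eq_image'] at hz
    obtain ⟨s, ⟨hs0, hs1⟩, rfl⟩ := hz
    refine ⟨s, hs0, hs1, ?_⟩
    rw [mem_closedBall_zero_iff] at hv
    simpa using hv
  obtain ⟨s, hs0, hs1, hs⟩ := near y (hTU hy)
  obtain ⟨t, ht0, ht1, ht⟩ := near (y + f) (hTU hyf)
  have hst : 1 - 2 * ρ ≤ |t - s| := by
    have h1 : f = (t - s) • e + ((y + f - (x + t • e)) - (y - (x + s • e))) := by module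
    have h2 : ‖f‖ ≤ |t - s| + (ρ + ρ) := by
      conv_lhs => rw [h1]
      refine (norm_add_le _ _).trans (add_le_add ?_ ((norm_sub_le _ _).trans (add_le_add ht hs)))
      rw [norm_smul, he, mul_one, Real.norm_eq_abs]
    linarith
  intro z hz
  obtain ⟨u, hu0, hu1, hu⟩ := near z hz
  obtain ⟨w, hw, hwn⟩ : ∃ w ∈ W, ‖x + u • e - w‖ ≤ 3 * ρ := by
    rcases le_total s t with h | h
    · rw [abs_of_nonneg (by linarith)] at hst
      exact key y (y + f) (hTW hy) (hTW hyf) s t hs0 ht1 hst hs ht u hu0 hu1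
    · rw [abs_of_nonpos (by linarith)] at hst
      exact key (y + f) y (hTW hyf) (hTW hy) t s ht0 hs1 (by linarith) ht hs u hu0 hu1
  refine ⟨w, hw, z - w, ?_, add_sub_cancel w z⟩
  rw [mem_closedBall_zero_iff]
  calc ‖z - w‖ = ‖(z - (x + u • e)) + (x + u • e - w)‖ := by congr 1; abel
    _ ≤ ρ + 3 * ρ := (norm_add_le _ _).trans (add_le_add hu hwn)
    _ = 4 * ρ := by ring

theorem tubeVol_pos {r : ℝ} (hr : 0 < r) : 0 < tubeVol r := by
  have hT : IsTube r (cthickening r (segment ℝ (0 : E3) (0 + EuclideanSpace.single 0 1))) :=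
    ⟨0, EuclideanSpace.single 0 1, by simp, rfl⟩
  obtain ⟨x, hx⟩ := hT.exists_closedBall_subset
  rw [← hT.vol_eq hr.le]
  exact (vol_closedBall_pos hr).trans_le (vol_closedBall_le (hT.isCompact hr.le).isBounded hx)

theorem IsTube.vol_closedBall_le_of_subset {r : ℝ} {T W : Set E3} (hT : IsTube r T)
    (hTW : T ⊆ W) (hW : Bornology.IsBounded W) : vol (closedBall (0 : E3) r) ≤ vol W := by
  obtain ⟨x, hx⟩ := hT.exists_closedBall_subset
  exact vol_closedBall_le hW (hx.trans hTW)

theorem ncard_le_KTCWfam {δ : ℝ} (hδ : 0 < δ) {ι : Type} [Fintype ι] {T : ι → Set E3}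
    (hT : ∀ i, IsTube δ (T i)) (s : Set ι) {W : Set E3} (hW : Convex ℝ W)
    (hWb : Bornology.IsBounded W) :
    (Set.ncard {i | i ∈ s ∧ T i ⊆ W} : ℝ) ≤
      KTCWfam (tubeVol δ) T s * vol W / tubeVol δ := by
  refine le_sInf_mul_vol (n := fun W => Set.ncard {i | i ∈ s ∧ T i ⊆ W})
    (N := (Set.univ : Set ι).ncard) (vol_closedBall_pos hδ) (tubeVol_pos hδ)
    (fun U => Set.ncard_le_ncard (Set.subset_univ _)) (fun U _ hUb h => ?_) hW hWb
  obtain ⟨i, -, hi⟩ := Set.nonempty_of_ncard_ne_zero h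
  exact (hT i).vol_closedBall_le_of_subset hi hUb

theorem ncard_le_KTCW {ρ : ℝ} (hρ : 0 < ρ) {𝕋 : Finset (Set E3)}
    (hT : ∀ T ∈ 𝕋, IsTube ρ T) {W : Set E3} (hW : Convex ℝ W)
    (hWb : Bornology.IsBounded W) :
    (Set.ncard {T | T ∈ 𝕋 ∧ T ⊆ W} : ℝ) ≤ KTCW ρ 𝕋 * vol W / tubeVol ρ := by
  refine le_sInf_mul_vol (n := fun W => Set.ncard {T | T ∈ 𝕋 ∧ T ⊆ W})
    (N := (𝕋 : Set (Set E3)).ncard) (vol_closedBall_pos hρ) (tubeVol_pos hρ)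
    (fun U => Set.ncard_le_ncard (fun T h => h.1) 𝕋.finite_toSet) (fun U _ hUb h => ?_) hW hWb
  obtain ⟨T, hT', hTU⟩ := Set.nonempty_of_ncard_ne_zero h
  exact (hT T hT').vol_closedBall_le_of_subset hTU hUb

theorem ncard_subset_le_of_cover {δ ρ : ℝ} (hδ : 0 < δ) (hρ : 0 < ρ) {ι : Type} [Fintype ι]
    {T : ι → Set E3} {𝕋ρ : Finset (Set E3)} (hT : ∀ i, IsTube δ (T i))
    (hTρ : ∀ U ∈ 𝕋ρ, IsTube ρ U) (hcov : ∀ i, ∃ U ∈ 𝕋ρ, T i ⊆ U) {s : ℝ} (hs0 : 0 ≤ s)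
    (hs : ∀ U ∈ 𝕋ρ, KTCWfam (tubeVol δ) T {i | T i ⊆ U} ≤ s) {W : Set E3}
    (hW : Convex ℝ W) (hWc : IsCompact W) :
    (Set.ncard {i | T i ⊆ W} : ℝ) ≤ 4096 * s * KTCW ρ 𝕋ρ * vol W / tubeVol δ := by
  have htδ := tubeVol_pos hδ
  have htρ := tubeVol_pos hρ
  have hvW : 0 ≤ vol W := ENNReal.toReal_nonneg
  set V : Set E3 := W + closedBall (0 : E3) (4 * ρ) with hV
  have hVc : IsCompact V := hWc.add (isCompact_closedBall _ _)
  have hVconv : Convex ℝ V := hW.add (convex_closedBall _ _)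
  set F : Finset (Set E3) := 𝕋ρ.filter (fun U => ∃ i, T i ⊆ U ∧ T i ⊆ W) with hF
  have hFcard : (F.card : ℝ) * tubeVol ρ ≤ KTCW ρ 𝕋ρ * vol V := by
    rw [← le_div_iff₀ htρ]
    refine le_trans ?_ (ncard_le_KTCW hρ hTρ hVconv hVc.isBounded)
    rw [← Set.ncard_coe_finset]
    refine Nat.cast_le.2 (Set.ncard_le_ncard (fun U hU => ?_)
      (𝕋ρ.finite_toSet.subset fun U hU => hU.1))
    obtain ⟨hU, i, hiU, hiW⟩ := Finset.mem_filter.1 (Finset.mem_coe.1 hU)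
    exact ⟨hU, (hT i).subset_add_closedBall hρ.le (hTρ U hU) hiU hW hiW⟩
  have hcount : (Set.ncard {i | T i ⊆ W} : ℝ) * tubeVol δ ≤ ∑ U ∈ F, s * vol (W ∩ U) := by
    have h1 : Set.ncard {i | T i ⊆ W} ≤
        ∑ U ∈ F, Set.ncard {i | i ∈ {i | T i ⊆ U} ∧ T i ⊆ W ∩ U} := by
      refine le_trans (Set.ncard_le_ncard (t := ⋃ U ∈ F, {i | i ∈ {i | T i ⊆ U} ∧ T i ⊆ W ∩ U})
        (fun i hi => ?_)) (Finset.set_ncard_biUnion_le _ _)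
      obtain ⟨U, hU, hiU⟩ := hcov i
      exact Set.mem_biUnion (Finset.mem_coe.2 (Finset.mem_filter.2 ⟨hU, i, hiU, hi⟩))
        ⟨hiU, Set.subset_inter hi hiU⟩
    calc (Set.ncard {i | T i ⊆ W} : ℝ) * tubeVol δ
        ≤ (∑ U ∈ F, (Set.ncard {i | i ∈ {i | T i ⊆ U} ∧ T i ⊆ W ∩ U} : ℝ)) * tubeVol δ := by
          gcongr
          exact_mod_cast h1
      _ = ∑ U ∈ F, (Set.ncard {i | i ∈ {i | T i ⊆ U} ∧ T i ⊆ W ∩ U} : ℝ) * tubeVol δ :=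
          Finset.sum_mul _ _ _
      _ ≤ _ := by
          refine Finset.sum_le_sum fun U hU => ?_
          have hU' := (Finset.mem_filter.1 hU).1
          rw [← le_div_iff₀ htδ]
          refine (ncard_le_KTCWfam hδ hT _ (hW.inter (hTρ U hU').convex)
            (hWc.isBounded.subset Set.inter_subset_left)).trans ?_
          have : 0 ≤ vol (W ∩ U) := ENNReal.toReal_nonneg
          gcongr
          exact hs U hU'
  have hinter : ∀ U ∈ F, s * vol (W ∩ U) * vol V ≤ s * (4096 * (vol W * tubeVol ρ)) := by
    intro U hU
    have hU' := hTρ U (Finset.mem_filter.1 hU).1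
    obtain ⟨x, hx⟩ := hU'.exists_closedBall_subset
    rw [mul_assoc, ← hU'.vol_eq hρ.le]
    refine mul_le_mul_of_nonneg_left ?_ hs0
    exact vol_inter_mul_vol_add_closedBall_le hWc (hU'.isCompact hρ.le) hW hU'.convex hx
  rcases {i | T i ⊆ W}.eq_empty_or_nonempty with h0 | ⟨i, hi⟩
  · rw [h0, Set.ncard_empty, Nat.cast_zero]
    have : 0 ≤ KTCW ρ 𝕋ρ := Real.sInf_nonneg fun C hC => hC.1.le
    positivity
  have hVpos : 0 < vol V := by
    have hsub : W ⊆ V := fun w hw =>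
      ⟨w, hw, 0, mem_closedBall_self (by positivity), add_zero w⟩
    exact (vol_closedBall_pos hδ).trans_le
      ((hT i).vol_closedBall_le_of_subset (Set.Subset.trans hi hsub) hVc.isBounded)
  rw [le_div_iff₀ htδ]
  refine hcount.trans (le_of_mul_le_mul_right ?_ hVpos)
  calc (∑ U ∈ F, s * vol (W ∩ U)) * vol V = ∑ U ∈ F, s * vol (W ∩ U) * vol V :=
        Finset.sum_mul _ _ _
    _ ≤ ∑ _U ∈ F, s * (4096 * (vol W * tubeVol ρ)) := Finset.sum_le_sum hinter
    _ = 4096 * s * vol W * (F.card * tubeVol ρ) := by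
        rw [Finset.sum_const, nsmul_eq_mul]; ring
    _ ≤ 4096 * s * vol W * (KTCW ρ 𝕋ρ * vol V) := by gcongr
    _ = 4096 * s * KTCW ρ 𝕋ρ * vol W * vol V := by ring

end NeighbourhoodEstimates

/-- Lemma 2.13: the Katz–Tao Convex Wolff constant is sub-multiplicative with respect to
covers: `C_{KT-CW}(𝕋) ≤ C · (sup_{T_ρ} C_{KT-CW}(𝕋^{T_ρ})) · C_{KT-CW}(𝕋_ρ)`. -/
theorem ktcw_submultiplicative :
    ∃ C : ℝ, 0 < C ∧
      ∀ (δ ρ : ℝ), 0 < δ → δ ≤ ρ → ρ ≤ 1 →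
        ∀ (ι : Type) [Fintype ι] (T : ι → Set E3) (𝕋ρ : Finset (Set E3)),
          (∀ i, IsTube δ (T i) ∧ T i ⊆ Metric.closedBall 0 1) →
          (∀ Tρ ∈ 𝕋ρ, IsTube ρ Tρ) →
          -- 𝕋_ρ covers 𝕋
          (∀ i, ∃ Tρ ∈ 𝕋ρ, T i ⊆ Tρ) →
          -- s bounds sup_{T_ρ∈𝕋_ρ} C_{KT-CW}(𝕋^{T_ρ})
          ∀ s : ℝ, (∀ Tρ ∈ 𝕋ρ, KTCWfam (tubeVol δ) T {i | T i ⊆ Tρ} ≤ s) →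
            KTCWfam (tubeVol δ) T Set.univ ≤ C * s * KTCW ρ 𝕋ρ := by
  refine ⟨4096, by norm_num, fun δ ρ hδ hδρ hρ1 ι _ T 𝕋ρ hT hTρ hcov s hs => ?_⟩
  have hρ : 0 < ρ := hδ.trans_le hδρ
  have hK0 : 0 ≤ KTCW ρ 𝕋ρ := Real.sInf_nonneg fun C hC => hC.1.le
  rcases isEmpty_or_nonempty ι with hι | ⟨⟨i⟩⟩
  · have h0 : KTCWfam (tubeVol δ) T Set.univ ≤ 0 := by
      refine le_of_forall_pos_le_add fun ε hε => ?_
      rw [zero_add]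
      refine csInf_le ⟨0, fun C hC => hC.1.le⟩ ⟨hε, fun W _ _ => ?_⟩
      have := tubeVol_pos hδ
      have hvW : 0 ≤ vol W := ENNReal.toReal_nonneg
      rw [Set.eq_empty_of_isEmpty {i | i ∈ Set.univ ∧ T i ⊆ W}, Set.ncard_empty, Nat.cast_zero]
      positivity
    rcases 𝕋ρ.eq_empty_or_nonempty with rfl | ⟨U, hU⟩
    · have h1 : KTCW ρ ∅ = 0 := by
        refine le_antisymm (le_of_forall_pos_le_add fun ε hε => ?_) hK0
        rw [zero_add]
        refine csInf_le ⟨0, fun C hC => hC.1.le⟩ ⟨hε, fun W _ _ => ?_⟩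
        have := tubeVol_pos hρ
        have hvW : 0 ≤ vol W := ENNReal.toReal_nonneg
        simp only [Finset.notMem_empty, false_and, Set.ofPred_false, Set.ncard_empty,
          Nat.cast_zero]
        positivity
      rw [h1, mul_zero]
      exact h0
    · have hs0 : 0 ≤ s := le_trans (Real.sInf_nonneg fun C hC => hC.1.le) (hs U hU)
      exact h0.trans (by positivity)
  · obtain ⟨U, hU, -⟩ := hcov i
    have hs0 : 0 ≤ s := le_trans (Real.sInf_nonneg fun C hC => hC.1.le) (hs U hU)
    refine le_of_forall_pos_le_add fun ε hε => ?_
    refine csInf_le ⟨0, fun C hC => hC.1.le⟩ ⟨by positivity, fun W hW hWb => ?_⟩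
    have htδ := tubeVol_pos hδ
    have hvW : 0 ≤ vol W := ENNReal.toReal_nonneg
    have hcl : vol (closure W) = vol W := by
      unfold vol
      rw [measure_closure_of_null_frontier (hW.addHaar_frontier volume)]
    have hmain := ncard_subset_le_of_cover hδ hρ (fun i => (hT i).1) hTρ hcov hs0 hs
      hW.closure hWb.isCompact_closure
    rw [hcl] at hmain
    calc (Set.ncard {i | i ∈ Set.univ ∧ T i ⊆ W} : ℝ) ≤ Set.ncard {i | T i ⊆ closure W} :=
          Nat.cast_le.2 (Set.ncard_le_ncard fun i hi => hi.2.trans subset_closure)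
      _ ≤ _ := hmain
      _ ≤ _ := by gcongr; linarith

end
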